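/- arXiv:1506.06451 — 3 statements merged into one kernel-verified Lean document; each statement's English description precedes it below -/
import Mathlib

section
/- Fix an integer r. If d_r : E^{p,q}_r → E^{p+r,q-r+1}_r is the zero map for all integers p, q, then α_{p,q,r} is an isomorphism for all integers p, q. -/
open Submodule

/-- A double complex of `k`-vector spaces: `A = ⊕_{p,q ∈ ℤ} A^{p,q}` with `A^{p,q} = 0`
for `p < 0` or `q < 0`, with anticommuting differentials `d' : A^{p,q} → A^{p+1,q}` and
`d'' : A^{p,q} → A^{p,q+1}` squaring to zero. -/
structure DoubleComplex (k : Type*) [Field k] (V : Type*) [AddCommGroup V] [Module k V] where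
  A : ℤ → ℤ → Submodule k V
  isInternal : DirectSum.IsInternal (fun pq : ℤ × ℤ => A pq.1 pq.2)
  vanish : ∀ p q : ℤ, p < 0 ∨ q < 0 → A p q = ⊥
  d' : V →ₗ[k] V
  d'' : V →ₗ[k] V
  mapA_d' : ∀ p q : ℤ, (A p q).map d' ≤ A (p + 1) q
  mapA_d'' : ∀ p q : ℤ, (A p q).map d'' ≤ A p (q + 1)
  d'_d' : d' ∘ₗ d' = 0
  d''_d'' : d'' ∘ₗ d'' = 0
  anticomm : d' ∘ₗ d'' + d'' ∘ₗ d' = 0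

namespace DoubleComplex

variable {k : Type*} [Field k] {V : Type*} [AddCommGroup V] [Module k V]
variable (C : DoubleComplex k V)

/-- The total differential `d = d' + d''`. -/
def dTot : V →ₗ[k] V := C.d' + C.d''

lemma dd_apply (x : V) : C.dTot (C.dTot x) = 0 := by
  have h1 := LinearMap.ext_iff.mp C.d'_d' x
  have h2 := LinearMap.ext_iff.mp C.d''_d'' x
  have h3 := LinearMap.ext_iff.mp C.anticomm x
  simp only [LinearMap.comp_apply, LinearMap.zero_apply, LinearMap.add_apply] at h1 h2 h3
  simp only [dTot, LinearMap.add_apply, map_add]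
  rw [h1, h2, zero_add, add_zero, add_comm]
  exact h3

/-- The filtration `F^p A^n = ⊕_{s ≥ p} A^{s, n-s}`. -/
def F (p n : ℤ) : Submodule k V := ⨆ (s : ℤ) (_ : p ≤ s), C.A s (n - s)

lemma F_antitone {p p' : ℤ} (h : p ≤ p') (n : ℤ) : C.F p' n ≤ C.F p n :=
  biSup_mono fun s hs => le_trans h hs

/-- `Z^{p,q}_r = {ξ ∈ F^p A^{p+q} : dξ ∈ F^{p+r} A^{p+q+1}}`. -/
def Z (p q r : ℤ) : Submodule k V :=
  C.F p (p + q) ⊓ (C.F (p + r) (p + q + 1)).comap C.dTot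

/-- `Z^{p,q}_∞ = F^p A^{p+q} ∩ ker d`. -/
def Zinf (p q : ℤ) : Submodule k V := C.F p (p + q) ⊓ LinearMap.ker C.dTot

/-- `B^{p,q}_r = F^p A^{p+q} ∩ d(F^{p-r} A^{p+q-1})`. -/
def B (p q r : ℤ) : Submodule k V :=
  C.F p (p + q) ⊓ (C.F (p - r) (p + q - 1)).map C.dTot

/-- `B^{p,q}_∞ = F^p A^{p+q} ∩ im d`. -/
def Binf (p q : ℤ) : Submodule k V := C.F p (p + q) ⊓ LinearMap.range C.dTot

lemma B_mono (p q : ℤ) {r r' : ℤ} (h : r ≤ r') : C.B p q r ≤ C.B p q r' :=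
  inf_le_inf le_rfl (Submodule.map_mono (C.F_antitone (by omega) _))

lemma Z_anti (p q : ℤ) {r r' : ℤ} (h : r' ≤ r) : C.Z p q r ≤ C.Z p q r' :=
  inf_le_inf le_rfl (Submodule.comap_mono (C.F_antitone (by omega) _))

/-- The denominator `Z^{p+1,q-1}_{r-1} + B^{p,q}_{r-1}` of `E^{p,q}_r`. -/
def Eden (p q r : ℤ) : Submodule k V := C.Z (p + 1) (q - 1) (r - 1) ⊔ C.B p q (r - 1)

/-- `E^{p,q}_r = Z^{p,q}_r / (Z^{p+1,q-1}_{r-1} + B^{p,q}_{r-1})`. -/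
abbrev E (p q r : ℤ) :=
  C.Z p q r ⧸ (C.Eden p q r).comap (C.Z p q r).subtype

/-- The common target `Z^{p,q}_r / (Z^{p+1,q-1}_{r-1} + B^{p,q}_r)` of `α_{p,q,r}` and
`β_{p,q,r}`. -/
abbrev T (p q r : ℤ) :=
  C.Z p q r ⧸ (C.Z (p + 1) (q - 1) (r - 1) ⊔ C.B p q r).comap (C.Z p q r).subtype

/-- `β_{p,q,r} : E^{p,q}_r → Z^{p,q}_r/(Z^{p+1,q-1}_{r-1} + B^{p,q}_r)`, induced by the
identity of `Z^{p,q}_r`. -/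
def beta (p q r : ℤ) : C.E p q r →ₗ[k] C.T p q r :=
  Submodule.mapQ _ _ LinearMap.id (by
    intro x hx
    simp only [Submodule.mem_comap, LinearMap.id_coe, id_eq] at hx ⊢
    exact sup_le_sup_left (C.B_mono p q (by omega)) _ hx)

/-- `α_{p,q,r} : E^{p,q}_{r+1} → Z^{p,q}_r/(Z^{p+1,q-1}_{r-1} + B^{p,q}_r)`, induced by the
inclusion `Z^{p,q}_{r+1} ⊆ Z^{p,q}_r`. -/
def alpha (p q r : ℤ) : C.E p q (r + 1) →ₗ[k] C.T p q r :=
  Submodule.mapQ _ _ (Submodule.inclusion (C.Z_anti p q (by omega : r ≤ r + 1))) (by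
    rw [← Submodule.comap_comp, Submodule.subtype_comp_inclusion]
    exact Submodule.comap_mono
      (sup_le_sup (C.Z_anti _ _ (by omega)) (C.B_mono _ _ (by omega))))

lemma d_Z (p q r : ℤ) : ∀ x ∈ C.Z p q r, C.dTot x ∈ C.Z (p + r) (q - r + 1) r := by
  intro x hx
  rw [Z, Submodule.mem_inf] at hx ⊢
  obtain ⟨hx1, hx2⟩ := hx
  constructor
  · rw [show p + r + (q - r + 1) = p + q + 1 by ring]
    exact hx2
  · rw [Submodule.mem_comap, C.dd_apply]
    exact zero_mem _

lemma d_Eden (p q r : ℤ) : ∀ x ∈ C.Eden p q r, C.dTot x ∈ C.Eden (p + r) (q - r + 1) r := by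
  intro x hx
  rw [Eden, Submodule.mem_sup] at hx
  obtain ⟨y, hy, z, hz, rfl⟩ := hx
  rw [map_add]
  apply add_mem
  · apply Submodule.mem_sup_right
    rw [Z, Submodule.mem_inf] at hy
    obtain ⟨hy1, hy2⟩ := hy
    rw [Submodule.mem_comap] at hy2
    rw [B, Submodule.mem_inf]
    have e1 : (p + 1 + (r - 1) : ℤ) = p + r := by ring
    have e2 : (p + 1 + (q - 1) + 1 : ℤ) = p + r + (q - r + 1) := by ring
    have e3 : (p + 1 + (q - 1) : ℤ) = p + r + (q - r + 1) - 1 := by ring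
    rw [e1, e2] at hy2
    rw [e3] at hy1
    refine ⟨hy2, ?_⟩
    rw [show (p + r - (r - 1) : ℤ) = p + 1 by ring]
    exact Submodule.mem_map_of_mem hy1
  · rw [B, Submodule.mem_inf] at hz
    obtain ⟨hz1, hz2⟩ := hz
    rw [Submodule.mem_map] at hz2
    obtain ⟨w, hw, rfl⟩ := hz2
    rw [C.dd_apply]
    exact zero_mem _

/-- The restriction of the total differential to `Z^{p,q}_r → Z^{p+r,q-r+1}_r`. -/
def drAux (p q r : ℤ) : C.Z p q r →ₗ[k] C.Z (p + r) (q - r + 1) r :=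
  C.dTot.restrict (C.d_Z p q r)

/-- The induced differential `d_r : E^{p,q}_r → E^{p+r,q-r+1}_r`. -/
def dr (p q r : ℤ) : C.E p q r →ₗ[k] C.E (p + r) (q - r + 1) r :=
  Submodule.mapQ _ _ (C.drAux p q r) (by
    rw [drAux, ← Submodule.comap_comp, LinearMap.subtype_comp_restrict]
    show (C.Eden p q r).comap (C.Z p q r).subtype ≤
      (C.Eden (p + r) (q - r + 1) r).comap (C.dTot ∘ₗ (C.Z p q r).subtype)
    rw [Submodule.comap_comp]
    exact Submodule.comap_mono fun x hx => C.d_Eden p q r x hx)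

/-- The set `ℰ^{p,q}_r`: for `r ≥ 1` it consists of the elements
`ξ = ξ_0 + ⋯ + ξ_{r-1}` with `ξ_i ∈ A^{p+i,q-i}` such that `dξ = d'ξ_{r-1}`,
`d'ξ_{r-1} ∉ im d''`, and `ξ_0` is not the leading term of any `d`-closed element
(no `d`-closed `η ∈ F^p A^{p+q}` has component `ξ_0` in `A^{p,q}`, i.e. `η - ξ_0 ∈ F^{p+1}`);
and `ℰ^{p,q}_0 = B^{p,q+1}_0 \ (Z^{p+1,q}_{-1} + B^{p,q+1}_{-1})`. -/
def scrE (p q r : ℤ) : Set V :=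
  if 1 ≤ r then
    {ξ | ∃ c : ℕ → V, (∀ i : ℕ, c i ∈ C.A (p + i) (q - i)) ∧
        ξ = ∑ i ∈ Finset.range r.toNat, c i ∧
        C.dTot ξ = C.d' (c (r.toNat - 1)) ∧
        C.d' (c (r.toNat - 1)) ∉ LinearMap.range C.d'' ∧
        ¬∃ η, η ∈ C.F p (p + q) ∧ C.dTot η = 0 ∧ η - c 0 ∈ C.F (p + 1) (p + q)}
  else
    (C.B p (q + 1) 0 : Set V) \ ((C.Z (p + 1) q (-1) ⊔ C.B p (q + 1) (-1) : Submodule k V) : Set V)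

/-- The double complex satisfies the `d'd''`-lemma:
`im d' ∩ ker d'' ∩ A^{p,q} = ker d' ∩ im d'' ∩ A^{p,q} = im (d'd'') ∩ A^{p,q}` for all `p, q`. -/
def DDLemma : Prop :=
  ∀ p q : ℤ,
    LinearMap.range C.d' ⊓ LinearMap.ker C.d'' ⊓ C.A p q
        = LinearMap.ker C.d' ⊓ LinearMap.range C.d'' ⊓ C.A p q ∧
      LinearMap.range C.d' ⊓ LinearMap.ker C.d'' ⊓ C.A p q
        = LinearMap.range (C.d' ∘ₗ C.d'') ⊓ C.A p q

lemma mem_F_of_eq {p p' n n' : ℤ} {x : V} (hx : x ∈ C.F p n) (hp : p = p') (hn : n = n') :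
    x ∈ C.F p' n' := by
  subst hp hn
  exact hx

lemma mem_Z {p q r : ℤ} {x : V} :
    x ∈ C.Z p q r ↔ x ∈ C.F p (p + q) ∧ C.dTot x ∈ C.F (p + r) (p + q + 1) :=
  Iff.rfl

lemma dTot_eq_zero_of_mem_B {p q r : ℤ} {x : V} (hx : x ∈ C.B p q r) : C.dTot x = 0 := by
  obtain ⟨-, w, -, rfl⟩ := hx
  exact C.dd_apply w

lemma alpha_injective (p q r : ℤ) : Function.Injective (C.alpha p q r) := by
  rw [injective_iff_map_eq_zero]
  intro a ha
  obtain ⟨⟨x, hx⟩, rfl⟩ := Submodule.Quotient.mk_surjective _ a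
  rw [alpha, Submodule.mapQ_apply, Submodule.Quotient.mk_eq_zero, Submodule.mem_comap] at ha
  rw [Submodule.Quotient.mk_eq_zero, Submodule.mem_comap]
  obtain ⟨y, hy, b, hb, hyb⟩ := Submodule.mem_sup.mp ha
  replace hyb : y + b = x := hyb
  have hdx : C.dTot x ∈ C.F (p + (r + 1)) (p + q + 1) := hx.2
  have hdy : C.dTot y = C.dTot x := by
    rw [← hyb, map_add, C.dTot_eq_zero_of_mem_B hb, add_zero]
  refine Submodule.mem_sup.mpr ⟨y, C.mem_Z.mpr ⟨hy.1, ?_⟩, b, ?_, hyb⟩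
  · rw [hdy]
    exact C.mem_F_of_eq hdx (by ring) (by ring)
  · rwa [add_sub_cancel_right]

lemma dTot_mem_Eden_of_dr_eq_zero {p q r : ℤ} (h : C.dr p q r = 0) {x : V}
    (hx : x ∈ C.Z p q r) : C.dTot x ∈ C.Eden (p + r) (q - r + 1) r := by
  have h0 := LinearMap.congr_fun h (Submodule.Quotient.mk ⟨x, hx⟩)
  rw [dr, Submodule.mapQ_apply, LinearMap.zero_apply, Submodule.Quotient.mk_eq_zero,
    Submodule.mem_comap] at h0
  exact h0

lemma alpha_surjective_of_dr_eq_zero {p q r : ℤ} (h : C.dr p q r = 0) :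
    Function.Surjective (C.alpha p q r) := by
  intro a
  obtain ⟨⟨x, hx⟩, rfl⟩ := Submodule.Quotient.mk_surjective _ a
  obtain ⟨z, hz, b, ⟨hb, w, hw, rfl⟩, hzb⟩ :=
    Submodule.mem_sup.mp (C.dTot_mem_Eden_of_dr_eq_zero h hx)
  replace hw : w ∈ C.F (p + 1) (p + q) := C.mem_F_of_eq hw (by ring) (by ring)
  have hwZ : w ∈ C.Z (p + 1) (q - 1) (r - 1) :=
    C.mem_Z.mpr
      ⟨C.mem_F_of_eq hw rfl (by ring), C.mem_F_of_eq hb (by ring) (by ring)⟩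
  have hxw : x - w ∈ C.Z p q (r + 1) := by
    refine C.mem_Z.mpr ⟨sub_mem hx.1 (C.F_antitone (by omega) _ hw), ?_⟩
    rw [map_sub, show C.dTot x = z + C.dTot w from hzb.symm, add_sub_cancel_right]
    exact C.mem_F_of_eq hz.1 (by ring) (by ring)
  refine ⟨Submodule.Quotient.mk ⟨x - w, hxw⟩, ?_⟩
  rw [alpha, Submodule.mapQ_apply, Submodule.Quotient.eq, Submodule.mem_comap]
  refine Submodule.mem_sup_left ?_
  change x - w - x ∈ _
  rw [sub_sub_cancel_left]
  exact neg_mem hwZ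

theorem statement_6 (r : ℤ) (h : ∀ p q : ℤ, C.dr p q r = 0) :
    ∀ p q : ℤ, Function.Bijective ⇑(C.alpha p q r) := by
  exact fun p q => ⟨C.alpha_injective p q r, C.alpha_surjective_of_dr_eq_zero (h p q)⟩

end DoubleComplex
end

section
/- Fix an integer r_0 ≥ 1. If α_{p,q,r} is an isomorphism for all integers p, q and all integers r ≥ r_0, then ℰ^{p,q}_r = ∅ for all integers p, q and all r ≥ r_0. -/
open Submodule

namespace DoubleComplex

variable {k : Type*} [Field k] {V : Type*} [AddCommGroup V] [Module k V]
variable (C : DoubleComplex k V)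

lemma A_le_F {p s n t : ℤ} (hps : p ≤ s) (hn : s + t = n) : C.A s t ≤ C.F p n := by
  obtain rfl : t = n - s := by omega
  exact le_iSup₂_of_le s hps le_rfl

lemma F_eq_bot {p n : ℤ} (h : n < p) : C.F p n = ⊥ := by
  simp only [F, iSup_eq_bot]
  exact fun s hs => C.vanish _ _ (Or.inr (by omega))

lemma exists_sub_mem_of_mapQ_surjective {R M N : Type*} [Ring R] [AddCommGroup M] [Module R M]
    [AddCommGroup N] [Module R N] {P : Submodule R M} {Q : Submodule R N} {f : M →ₗ[R] N}
    {hf : P ≤ Q.comap f} (h : Function.Surjective (P.mapQ Q f hf)) (y : N) :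
    ∃ x, y - f x ∈ Q := by
  obtain ⟨e, he⟩ := h (Submodule.Quotient.mk y)
  obtain ⟨x, rfl⟩ := Submodule.Quotient.mk_surjective _ e
  exact ⟨x, (Submodule.Quotient.eq _).mp he.symm⟩

lemma exists_sub_mem_of_alpha_surjective {p q r : ℤ} (h : Function.Surjective (C.alpha p q r))
    {x : V} (hx : x ∈ C.Z p q r) :
    ∃ z ∈ C.Z p q (r + 1), x - z ∈ C.Z (p + 1) (q - 1) (r - 1) ⊔ C.B p q r := by
  unfold alpha at h
  obtain ⟨z, hz⟩ := exists_sub_mem_of_mapQ_surjective h ⟨x, hx⟩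
  rw [Submodule.mem_comap, map_sub, Submodule.subtype_apply, Submodule.subtype_apply,
    Submodule.coe_inclusion] at hz
  exact ⟨z, z.2, hz⟩

/-- If `α_{p,q,s}` is surjective for all `s ≥ r`, every element of `Z^{p,q}_r` agrees modulo
`F^{p+1}` with an element of `Z^{p,q}_{r+N}` plus a `d`-closed element of `F^p`. -/
lemma exists_mem_Z_add_closed {p q r : ℤ}
    (h : ∀ s, r ≤ s → Function.Surjective (C.alpha p q s)) {x : V} (hx : x ∈ C.Z p q r) (N : ℕ) :
    ∃ z ∈ C.Z p q (r + N), ∃ b ∈ C.Zinf p q, z + b - x ∈ C.F (p + 1) (p + q) := by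
  induction N with
  | zero => exact ⟨x, by simpa using hx, 0, zero_mem _, by simp⟩
  | succ N ih =>
    obtain ⟨z, hz, b, hb, hzb⟩ := ih
    obtain ⟨z', hz', hsub⟩ := C.exists_sub_mem_of_alpha_surjective (h _ (by omega)) hz
    obtain ⟨w, hw, b', hb', hwb⟩ := Submodule.mem_sup.mp hsub
    refine ⟨z', by simpa [add_assoc] using hz', b + b',
      add_mem hb ⟨hb'.1, C.dTot_eq_zero_of_mem_B hb'⟩, ?_⟩
    have hwF : w ∈ C.F (p + 1) (p + q) := by
      have := hw.1
      rwa [show p + 1 + (q - 1) = p + q by ring] at this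
    have e : z' + (b + b') - x = (z + b - x) - w := by
      rw [eq_sub_of_add_eq hwb]
      abel
    exact e ▸ sub_mem hzb hwF

/-- If `α_{p,q,s}` is surjective for all `s ≥ r`, every element of `Z^{p,q}_r` agrees modulo
`F^{p+1}` with a `d`-closed element of `F^p`. -/
lemma exists_closed_sub_mem {p q r : ℤ}
    (h : ∀ s, r ≤ s → Function.Surjective (C.alpha p q s)) {x : V} (hx : x ∈ C.Z p q r) :
    ∃ η ∈ C.Zinf p q, η - x ∈ C.F (p + 1) (p + q) := by
  obtain ⟨z, hz, b, hb, hzb⟩ := C.exists_mem_Z_add_closed h hx (q + 2 - r).toNat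
  refine ⟨z + b, add_mem ⟨hz.1, ?_⟩ hb, hzb⟩
  have hdz := hz.2
  rwa [SetLike.mem_coe, Submodule.mem_comap, C.F_eq_bot (by omega), Submodule.mem_bot] at hdz

theorem statement_9 (r₀ : ℤ) (hr₀ : 1 ≤ r₀)
    (h : ∀ p q r : ℤ, r₀ ≤ r → Function.Bijective ⇑(C.alpha p q r)) :
    ∀ p q r : ℤ, r₀ ≤ r → C.scrE p q r = ∅ := by
  intro p q r hr
  have hr1 : 1 ≤ r := hr₀.trans hr
  rw [scrE, if_pos hr1, Set.eq_empty_iff_forall_notMem]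
  rintro _ ⟨c, hc, rfl, hd, -, hη⟩
  have hcF (i : ℕ) : c i ∈ C.F p (p + q) := C.A_le_F (by omega) (by omega) (hc i)
  have hx : ∑ i ∈ Finset.range r.toNat, c i ∈ C.Z p q r := by
    refine ⟨sum_mem fun i _ => hcF i, ?_⟩
    rw [SetLike.mem_coe, Submodule.mem_comap, hd]
    exact C.A_le_F (by omega) (by omega)
      (C.mapA_d' _ _ (Submodule.mem_map_of_mem (hc (r.toNat - 1))))
  obtain ⟨η, ⟨hηF, hdη⟩, hsub⟩ :=
    C.exists_closed_sub_mem (fun s hs => (h p q s (hr.trans hs)).2) hx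
  refine hη ⟨η, hηF, hdη, ?_⟩
  have htail : ∑ i ∈ Finset.range r.toNat, c i - c 0 ∈ C.F (p + 1) (p + q) := by
    obtain ⟨n, hn⟩ : ∃ n, r.toNat = n + 1 := ⟨r.toNat - 1, by omega⟩
    rw [hn, Finset.sum_range_succ', add_sub_cancel_right]
    exact sum_mem fun i _ => C.A_le_F (by omega) (by omega) (hc (i + 1))
  simpa using add_mem hsub htail

end DoubleComplex
end

section
/- If the double complex (A, d', d'') satisfies the d'd''-lemma, then ℰ^{p,q}_r = ∅ for all integers p, q and all integers r ≥ 1. -/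
open Submodule

namespace DoubleComplex

variable {k : Type*} [Field k] {V : Type*} [AddCommGroup V] [Module k V]
variable (C : DoubleComplex k V)

theorem statement_16 (hdd : C.DDLemma) :
    ∀ p q r : ℤ, 1 ≤ r → C.scrE p q r = ∅ := by
  intro p q r hr
  rw [Set.eq_empty_iff_forall_notMem]
  intro ξ hξ
  rw [scrE, if_pos hr] at hξ
  obtain ⟨c, hc, -, hd, hnot, -⟩ := hξ
  set n := r.toNat - 1
  have hclosed : C.d'' (C.d' (c n)) = 0 := by
    have hdd' : C.dTot (C.d' (c n)) = 0 := hd ▸ C.dd_apply ξ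
    have hd'd' : C.d' (C.d' (c n)) = 0 := LinearMap.congr_fun C.d'_d' (c n)
    rwa [dTot, LinearMap.add_apply, hd'd', zero_add] at hdd'
  have hmem : C.d' (c n) ∈ LinearMap.range C.d' ⊓ LinearMap.ker C.d'' ⊓ C.A (p + n + 1) (q - n) :=
    ⟨⟨LinearMap.mem_range_self _ _, hclosed⟩, C.mapA_d' _ _ (Submodule.mem_map_of_mem (hc n))⟩
  rw [(hdd _ _).1] at hmem
  exact hnot hmem.1.2

end DoubleComplex
end
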